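/- Let the Euclidean plane ℝ² be coloured in red and blue so that there are no two red points at Euclidean distance 1 from each other. Then there exist five blue points that form an ℓ₅, i.e. there exist a point p and a unit vector w such that p, p+w, p+2w, p+3w, p+4w are all blue. -/

import Mathlib

/-- The two colours. -/
inductive Color
  | red
  | blue

/-- The Euclidean plane ℝ². -/
abbrev Plane : Type := EuclideanSpace ℝ (Fin 2)

/-! ### Bit-parallel unit propagation

A two-colouring `g : ℕ → Bool` is constrained by translates of finitely many forbidden patterns.
Partial knowledge about `g` is a pair of bit masks: the positions known to have colour `true`, and
those known to have colour `false`. -/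

namespace BitSearch

/-- A pattern of prescribed colours, at given offsets from an anchor. -/
abbrev Pattern := List (ℕ × Bool)

/-- The positions `n + q.1` with `n ∈ D` such that all entries of `P` other than `q` are known to
be matched when `P` is anchored at `n`. -/
def deduce (D R B : ℕ) (P : Pattern) (q : ℕ × Bool) : ℕ :=
  ((P.filter (· ≠ q)).foldr (fun r a => a &&& (cond r.2 R B >>> r.1)) D) <<< q.1

/-- The positions which unit propagation newly shows to have colour `c`. -/
def gain (D R B : ℕ) (pats : List Pattern) (c : Bool) : ℕ :=
  (pats.flatMap fun P => (P.filter (·.2 ≠ c)).map (deduce D R B P)).foldr (· ||| ·) 0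

/-- Function application that makes the kernel evaluate the argument first. -/
def force (n : ℕ) (k : ℕ → Bool) : Bool :=
  match n with
  | 0 => k 0
  | m + 1 => k (m + 1)

theorem force_eq (n : ℕ) (k : ℕ → Bool) : force n k = k n := by
  cases n <;> rfl

/-- Up to `fuel` rounds of unit propagation; `true` on a conflict, otherwise continue with `k`. -/
def saturate (D : ℕ) (pats : List Pattern) (k : ℕ → ℕ → Bool) : ℕ → ℕ → ℕ → Bool
  | 0, R, B => k R B
  | fuel + 1, R, B =>
    force (R ||| gain D R B pats true) fun R' =>
      force (B ||| gain D R B pats false) fun B' =>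
        if R' &&& B' = 0 then saturate D pats k fuel R' B' else true

/-- A decision tree: the positions to branch on. -/
inductive Plan
  | leaf
  | split (n : ℕ) (ifTrue ifFalse : Plan)

/-- Whether unit propagation along the given decision tree ends in conflicts only. -/
def refutes (D : ℕ) (pats : List Pattern) : Plan → ℕ → ℕ → Bool
  | .leaf, R, B => saturate D pats (fun _ _ => false) 12 R B
  | .split n s t, R, B =>
    saturate D pats
      (fun R' B' => refutes D pats s (R' ||| 1 <<< n) B' && refutes D pats t R' (B' ||| 1 <<< n))
      12 R B

/-- The masks `R` and `B` are correct information about `g`. -/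
def Sound (g : ℕ → Bool) (R B : ℕ) : Prop :=
  ∀ n, (R.testBit n = true → g n = true) ∧ (B.testBit n = true → g n = false)

theorem testBit_foldr_or (L : List ℕ) (n : ℕ) :
    (L.foldr (· ||| ·) 0).testBit n = true ↔ ∃ m ∈ L, m.testBit n = true := by
  induction L with
  | nil => simp
  | cons a L ih => simp [ih]

theorem testBit_foldr_and {α : Type*} (h : α → ℕ) (L : List α) (D n : ℕ) :
    (L.foldr (fun r a => a &&& h r) D).testBit n = true ↔
      D.testBit n = true ∧ ∀ r ∈ L, (h r).testBit n = true := by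
  induction L with
  | nil => simp
  | cons a L ih =>
    simp only [List.foldr_cons, Nat.testBit_and, Bool.and_eq_true, ih, List.forall_mem_cons]
    tauto

section

variable {g : ℕ → Bool} {D : ℕ} {pats : List Pattern}

theorem gain_sound
    (hpats : ∀ P ∈ pats, ∀ n, D.testBit n = true → ¬ ∀ q ∈ P, g (n + q.1) = q.2)
    {R B : ℕ} (h : Sound g R B) (c : Bool) {n : ℕ} (hn : (gain D R B pats c).testBit n = true) :
    g n = c := by
  rw [gain, testBit_foldr_or] at hn
  obtain ⟨m, hm, hmn⟩ := hn
  simp only [List.mem_flatMap, List.mem_map, List.mem_filter] at hm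
  obtain ⟨P, hP, q, ⟨hqP, hqc⟩, rfl⟩ := hm
  rw [deduce, Nat.testBit_shiftLeft, Bool.and_eq_true, testBit_foldr_and] at hmn
  obtain ⟨hle, hD, hrest⟩ := hmn
  have hle : q.1 ≤ n := by simpa using hle
  by_contra hne
  refine hpats P hP (n - q.1) hD fun r hr => ?_
  by_cases hrq : r = q
  · subst hrq
    rw [Nat.sub_add_cancel hle]
    have hqc : r.2 ≠ c := by simpa using hqc
    revert hne hqc
    cases g n <;> cases r.2 <;> cases c <;> simp
  · have hbit := hrest r (List.mem_filter.2 ⟨hr, by simpa using hrq⟩)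
    rw [Nat.testBit_shiftRight, Nat.add_comm] at hbit
    rcases r with ⟨s, _ | _⟩
    · exact (h _).2 hbit
    · exact (h _).1 hbit

theorem saturate_sound
    (hpats : ∀ P ∈ pats, ∀ n, D.testBit n = true → ¬ ∀ q ∈ P, g (n + q.1) = q.2)
    {k : ℕ → ℕ → Bool} (hk : ∀ R B, k R B = true → ¬ Sound g R B) (fuel : ℕ) :
    ∀ R B, saturate D pats k fuel R B = true → ¬ Sound g R B := by
  induction fuel with
  | zero => exact hk
  | succ fuel ih =>
    intro R B hrun h
    have h' : Sound g (R ||| gain D R B pats true) (B ||| gain D R B pats false) := by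
      intro n
      simp only [Nat.testBit_or, Bool.or_eq_true]
      exact ⟨fun hn => hn.elim (h n).1 (gain_sound hpats h true),
        fun hn => hn.elim (h n).2 (gain_sound hpats h false)⟩
    rw [saturate, force_eq, force_eq] at hrun
    split_ifs at hrun with hz
    · exact ih _ _ hrun h'
    · obtain ⟨n, hn⟩ := Nat.exists_testBit_of_ne_zero hz
      rw [Nat.testBit_and, Bool.and_eq_true] at hn
      have := (h' n).1 hn.1
      rw [(h' n).2 hn.2] at this
      cases this

theorem not_sound_of_refutes
    (hpats : ∀ P ∈ pats, ∀ n, D.testBit n = true → ¬ ∀ q ∈ P, g (n + q.1) = q.2) (t : Plan) :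
    ∀ R B, refutes D pats t R B = true → ¬ Sound g R B := by
  induction t with
  | leaf => exact saturate_sound hpats (fun R B h => by cases h) 12
  | split m s t ihs iht =>
    refine saturate_sound hpats (fun R B hrun h => ?_) 12
    rw [Bool.and_eq_true] at hrun
    have hbit : ∀ n, (1 <<< m).testBit n = true → n = m := fun n hn => by
      rw [Nat.one_shiftLeft, Nat.testBit_two_pow] at hn
      simpa using (of_decide_eq_true hn).symm
    cases hm : g m
    · refine iht _ _ hrun.2 fun n => ⟨(h n).1, fun hn => ?_⟩
      rw [Nat.testBit_or, Bool.or_eq_true] at hn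
      exact hn.elim (h n).2 fun hn => hbit n hn ▸ hm
    · refine ihs _ _ hrun.1 fun n => ⟨fun hn => ?_, (h n).2⟩
      rw [Nat.testBit_or, Bool.or_eq_true] at hn
      exact hn.elim (h n).1 fun hn => hbit n hn ▸ hm

end

end BitSearch

/-! ### Forbidden patterns in `ℤ⁴` -/

namespace LatticeSearch

open BitSearch

/-- The lattice `ℤ⁴`. -/
abbrev Vec := ℤ × ℤ × ℤ × ℤ

/-- No translate of the pattern `P` occurs in the colouring `f`. -/
def Avoids (f : Vec → Bool) (P : List (Vec × Bool)) : Prop :=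
  ∀ p, ¬ ∀ q ∈ P, f (p + q.1) = q.2

/-- A linear form which is injective on the cube `[-8, 8]⁴`. -/
def lin (x : Vec) : ℤ := x.1 + 17 * x.2.1 + 289 * x.2.2.1 + 4913 * x.2.2.2

/-- The bit position which represents a point of the cube `[-8, 8]⁴`. -/
def code (x : Vec) : ℕ := (lin x + 41760).toNat

/-- The point represented by a bit position. -/
def decode (n : ℕ) : Vec :=
  ((n : ℤ) % 17 - 8, (n : ℤ) / 17 % 17 - 8, (n : ℤ) / 289 % 17 - 8, (n : ℤ) / 4913 - 8)

/-- The cube `[-k, k]⁴`, as a condition that can be evaluated. -/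
def inCube (k : ℤ) (x : Vec) : Bool :=
  decide (-k ≤ x.1) && decide (x.1 ≤ k) && decide (-k ≤ x.2.1) && decide (x.2.1 ≤ k) &&
  decide (-k ≤ x.2.2.1) && decide (x.2.2.1 ≤ k) && decide (-k ≤ x.2.2.2) && decide (x.2.2.2 ≤ k)

theorem inCube_add {x y : Vec} (hx : inCube 4 x = true) (hy : inCube 4 y = true) :
    inCube 8 (x + y) = true := by
  simp only [inCube, Bool.and_eq_true, decide_eq_true_eq, Prod.fst_add, Prod.snd_add] at *
  omega

theorem decode_code {x : Vec} (hx : inCube 8 x = true) : decode (code x) = x := by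
  obtain ⟨a, b, c, d⟩ := x
  simp only [inCube, Bool.and_eq_true, decide_eq_true_eq] at hx
  simp only [decode, code, lin, Prod.mk.injEq]
  omega

theorem code_add {x y : Vec} (hx : inCube 4 x = true) (hy : 0 ≤ lin y) :
    code (x + y) = code x + (lin y).toNat := by
  simp only [inCube, Bool.and_eq_true, decide_eq_true_eq] at hx
  simp only [code, lin, Prod.fst_add, Prod.snd_add] at *
  omega

/-- The bit mask of a list of points. -/
def mask (L : List Vec) : ℕ := (L.map fun x => 1 <<< code x).foldr (· ||| ·) 0

theorem testBit_mask {L : List Vec} {n : ℕ} (h : (mask L).testBit n = true) :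
    ∃ x ∈ L, n = code x := by
  rw [mask, testBit_foldr_or] at h
  obtain ⟨m, hm, hn⟩ := h
  obtain ⟨x, hx, rfl⟩ := List.mem_map.1 hm
  rw [Nat.one_shiftLeft, Nat.testBit_two_pow] at hn
  exact ⟨x, hx, (of_decide_eq_true hn).symm⟩

/-- The points of `[-k, k]² × [-l, l]²`. -/
def box (k l : ℕ) : List Vec :=
  let I (m : ℕ) : List ℤ := (List.range (2 * m + 1)).map fun i => (i : ℤ) - m
  I k ×ˢ I k ×ˢ I l ×ˢ I l

/-- Whether the patterns `pats`, anchored at the points of `starts`, refute the partial colouring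
with red points `reds`, by unit propagation along the decision tree `t`. -/
def check (pats : List (List (Vec × Bool))) (starts reds : List Vec) (t : Plan) : Bool :=
  pats.all (fun P => P.all fun q => decide (0 ≤ lin q.1) && inCube 4 q.1) &&
  starts.all (inCube 4) && reds.all (inCube 4) &&
  force (mask starts) fun D =>
    refutes D (pats.map fun P => P.map fun q => ((lin q.1).toNat, q.2)) t (mask reds) 0

theorem exists_blue_of_check {f : Vec → Bool} {pats : List (List (Vec × Bool))}
    (hpats : ∀ P ∈ pats, Avoids f P) {starts reds : List Vec} {t : Plan}
    (hcheck : check pats starts reds t = true) : ∃ x ∈ reds, f x = false := by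
  simp only [check, Bool.and_eq_true, List.all_eq_true, force_eq, decide_eq_true_eq] at hcheck
  obtain ⟨⟨⟨hP, hS⟩, hR⟩, hrun⟩ := hcheck
  by_contra! hred
  refine not_sound_of_refutes (g := fun n => f (decode n)) ?_ t _ _ hrun fun n =>
    ⟨fun hn => ?_, fun hn => by simp at hn⟩
  · intro P' hP' n hn hall
    obtain ⟨P, hPmem, rfl⟩ := List.mem_map.1 hP'
    obtain ⟨x, hx, rfl⟩ := testBit_mask hn
    refine hpats P hPmem x fun q hq => ?_
    have hq' := hP P hPmem q hq
    have := hall _ (List.mem_map_of_mem hq)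
    rwa [← code_add (hS x hx) hq'.1, decode_code (inCube_add (hS x hx) hq'.2)] at this
  · obtain ⟨x, hx, rfl⟩ := testBit_mask hn
    have h8 : inCube 8 x = true := by simpa using inCube_add (hR x hx) (y := 0) rfl
    simpa [decode_code h8] using hred x hx

/-- Two red points with difference `u`. -/
def redPair (u : Vec) : List (Vec × Bool) := [(0, true), (u, true)]

/-- Five blue points in arithmetic progression with difference `u`. -/
def blueFive (u : Vec) : List (Vec × Bool) :=
  (List.range 5).map fun k : ℕ => ((k : ℤ) • u, false)

/-- The unit vectors `1, ω, ω²` of the triangular lattice. -/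
def triUnits : List Vec := [(1, 0, 0, 0), (0, 1, 0, 0), (-1, 1, 0, 0)]

/-- The unit vectors `η, ωη, ω²η` of the rotated triangular lattice. -/
def rotUnits : List Vec := [(0, 0, 1, 0), (0, 0, 0, 1), (0, 0, -1, 1)]

/-- The unit vectors `ωᵏ(1 + ω)(η - 1)`. -/
def diffUnits : List Vec := [(-1, -1, 1, 1), (1, -2, -1, 2), (2, -1, -2, 1)]

/-- The patterns that show the absence of red equilateral triangles of side `√3`. -/
def mosPatterns : List (List (Vec × Bool)) :=
  (triUnits ++ rotUnits ++ diffUnits).map redPair ++ (triUnits ++ rotUnits).map blueFive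

/-- The red equilateral triangles of side `√3` in the triangular lattice. -/
def redTriangles : List (List (Vec × Bool)) :=
  [[(0, true), ((1, 1, 0, 0), true), ((-1, 2, 0, 0), true)],
    [(0, true), ((-1, 2, 0, 0), true), ((-2, 1, 0, 0), true)]]

/-- The patterns that show the absence of red pairs at distances `2, 3, 4`. -/
def triPatterns : List (List (Vec × Bool)) :=
  triUnits.map redPair ++ triUnits.map blueFive ++ redTriangles

theorem check_triangle :
    check mosPatterns (box 3 3) [0, (1, 1, 0, 0), (-1, 2, 0, 0)]
      (.split (code (0, 0, 2, -1)) .leaf (.split (code (-1, 2, -1, -1)) .leaf .leaf)) = true := by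
  decide +kernel

theorem check_two : check triPatterns (box 4 0) [0, (2, 0, 0, 0)] .leaf = true := by
  decide +kernel

theorem check_three : check triPatterns (box 4 0) [0, (3, 0, 0, 0)] .leaf = true := by
  decide +kernel

theorem check_four :
    check triPatterns (box 4 0) [0, (4, 0, 0, 0)]
      (.split (code (1, 1, 0, 0)) .leaf .leaf) = true := by
  decide +kernel

end LatticeSearch

/-! ### Colourings of the complex plane -/

namespace UnitDistance

open Complex LatticeSearch

/-- The sixth root of unity `(1 + √3 i) / 2`. -/
noncomputable def ω : ℂ := ⟨1 / 2, √3 / 2⟩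

/-- The unit complex number `(5 + √11 i) / 6`, for which `‖η - 1‖ = 1 / √3`. -/
noncomputable def η : ℂ := ⟨5 / 6, √11 / 6⟩

theorem ω_sq : ω ^ 2 = ω - 1 := by
  have h3 : √3 * √3 = 3 := Real.mul_self_sqrt (by norm_num)
  apply Complex.ext
  · simp only [ω, sq, mul_re, sub_re, one_re]
    linarith
  · simp only [ω, sq, mul_im, sub_im, one_im]
    ring

theorem norm_eq_one_of_normSq {z : ℂ} (h : normSq z = 1) : ‖z‖ = 1 := by
  rw [normSq_eq_norm_sq] at h
  exact (pow_eq_one_iff_of_nonneg (norm_nonneg z) two_ne_zero).1 h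

theorem norm_ω : ‖ω‖ = 1 := by
  have h3 : √3 * √3 = 3 := Real.mul_self_sqrt (by norm_num)
  apply norm_eq_one_of_normSq
  simp only [ω, normSq_mk]
  linarith

theorem norm_η : ‖η‖ = 1 := by
  have h11 : √11 * √11 = 11 := Real.mul_self_sqrt (by norm_num)
  apply norm_eq_one_of_normSq
  simp only [η, normSq_mk]
  linarith

theorem norm_one_add_ω_mul : ‖(1 + ω) * (η - 1)‖ = 1 := by
  have h3 : √3 * √3 = 3 := Real.mul_self_sqrt (by norm_num)
  have h11 : √11 * √11 = 11 := Real.mul_self_sqrt (by norm_num)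
  apply norm_eq_one_of_normSq
  simp only [map_mul, normSq_apply, ω, η, add_re, sub_re, add_im, sub_im, one_re, one_im]
  nlinarith

/-- The homomorphism from `ℤ⁴` to the plane with values `1, ω, η, ωη` on the standard basis. -/
noncomputable def embed (x : Vec) : ℂ :=
  x.1 + x.2.1 * ω + x.2.2.1 * η + x.2.2.2 * (ω * η)

theorem embed_add (x y : Vec) : embed (x + y) = embed x + embed y := by
  simp only [embed, Prod.fst_add, Prod.snd_add]
  push_cast
  ring

theorem embed_zsmul (k : ℤ) (x : Vec) : embed (k • x) = k * embed x := by
  simp only [embed, Prod.smul_fst, Prod.smul_snd, smul_eq_mul]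
  push_cast
  ring

theorem embed_zero : embed 0 = 0 := by
  simp [embed]

theorem norm_embed {u : Vec} (hu : u ∈ triUnits ++ rotUnits ++ diffUnits) : ‖embed u‖ = 1 := by
  have h : embed u ∈ [1, ω, ω ^ 2, η, ω * η, ω ^ 2 * η, (1 + ω) * (η - 1),
      ω * ((1 + ω) * (η - 1)), ω ^ 2 * ((1 + ω) * (η - 1))] := by
    have hω := ω_sq
    fin_cases hu <;> simp only [embed, List.mem_cons] <;> push_cast
    · exact .inl (by ring)
    · exact .inr (.inl (by ring))
    · exact .inr (.inr (.inl (by linear_combination -hω)))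
    · exact .inr (.inr (.inr (.inl (by ring))))
    · exact .inr (.inr (.inr (.inr (.inl (by ring)))))
    · exact .inr (.inr (.inr (.inr (.inr (.inl (by linear_combination (-η) * hω))))))
    · exact .inr (.inr (.inr (.inr (.inr (.inr (.inl (by ring)))))))
    · exact .inr (.inr (.inr (.inr (.inr (.inr (.inr (.inl
        (by linear_combination (1 - η) * hω))))))))
    · exact .inr (.inr (.inr (.inr (.inr (.inr (.inr (.inr (.inl
        (by linear_combination (2 + ω) * (1 - η) * hω)))))))))
  simp only [List.mem_cons, List.not_mem_nil, or_false] at h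
  rcases h with h | h | h | h | h | h | h | h | h <;>
    simp only [h, norm_mul, norm_pow, norm_ω, norm_η, norm_one, one_pow, mul_one, one_mul] <;>
    simpa only [norm_mul] using norm_one_add_ω_mul

/-- A colouring of the plane (`true` is red) with no two red points at distance `1` and no five
blue points in line with consecutive distances `1`. -/
structure Good (h : ℂ → Bool) : Prop where
  not_red_pair : ∀ z u, ‖u‖ = 1 → h z = true → h (z + u) = true → False
  exists_red : ∀ z u, ‖u‖ = 1 → ∃ k < 5, h (z + (k : ℕ) * u) = true

/-- The colouring of `ℤ⁴` induced by a point `p` and a unit vector `u`. -/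
noncomputable def pullback (h : ℂ → Bool) (p u : ℂ) (x : Vec) : Bool := h (p + u * embed x)

namespace Good

variable {h : ℂ → Bool} (hh : Good h)
include hh

theorem avoids_redPair {p u : ℂ} (hu : ‖u‖ = 1) {v : Vec}
    (hv : v ∈ triUnits ++ rotUnits ++ diffUnits) : Avoids (pullback h p u) (redPair v) := by
  intro x hx
  simp only [redPair, List.forall_mem_cons, pullback, embed_add, embed_zero] at hx
  refine hh.not_red_pair (p + u * embed x) (u * embed v)
    (by rw [norm_mul, hu, norm_embed hv, one_mul]) ?_ ?_
  · simpa using hx.1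
  · rw [← hx.2.1]
    ring_nf

theorem avoids_blueFive {p u : ℂ} (hu : ‖u‖ = 1) {v : Vec}
    (hv : v ∈ triUnits ++ rotUnits ++ diffUnits) : Avoids (pullback h p u) (blueFive v) := by
  intro x hx
  obtain ⟨k, hk, hred⟩ := hh.exists_red (p + u * embed x) (u * embed v)
    (by rw [norm_mul, hu, norm_embed hv, one_mul])
  have := hx _ (List.mem_map_of_mem (List.mem_range.2 hk))
  simp only [pullback, embed_add, embed_zsmul] at this
  rw [← Bool.not_eq_true] at this
  apply this
  rw [← hred]
  push_cast
  ring_nf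

theorem avoids_mosPatterns {p u : ℂ} (hu : ‖u‖ = 1) :
    ∀ P ∈ mosPatterns, Avoids (pullback h p u) P := by
  intro P hP
  rcases List.mem_append.1 hP with hP | hP <;> obtain ⟨v, hv, rfl⟩ := List.mem_map.1 hP
  · exact hh.avoids_redPair hu hv
  · exact hh.avoids_blueFive hu (List.mem_append_left _ hv)

theorem not_red_triangle {p u : ℂ} (hu : ‖u‖ = 1) (h₀ : h p = true)
    (h₁ : h (p + u * (1 + ω)) = true) (h₂ : h (p + u * (2 * ω - 1)) = true) : False := by
  obtain ⟨x, hx, hblue⟩ := exists_blue_of_check (hh.avoids_mosPatterns (p := p) hu) check_triangle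
  have hx' : h (p + u * embed x) = true := by
    fin_cases hx
    · simpa [embed] using h₀
    · simpa [embed] using h₁
    · rw [← h₂]
      congr 1
      simp only [embed]
      push_cast
      ring
  simp [pullback, hx'] at hblue

theorem avoids_redTriangles {p u : ℂ} (hu : ‖u‖ = 1) :
    ∀ P ∈ redTriangles, Avoids (pullback h p u) P := by
  intro P hP x hx
  fin_cases hP <;>
    simp only [List.forall_mem_cons, pullback, embed_add, embed_zero, add_zero] at hx <;>
    obtain ⟨h₀, h₁, h₂, -⟩ := hx
  · refine hh.not_red_triangle hu h₀ ?_ ?_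
    · rw [← h₁]
      simp [embed]
      ring_nf
    · rw [← h₂]
      simp [embed]
      ring_nf
  · refine hh.not_red_triangle (u := u * ω) (by rw [norm_mul, hu, norm_ω, one_mul]) h₀ ?_ ?_
    · rw [← h₁]
      congr 1
      simp [embed]
      linear_combination u * ω_sq
    · rw [← h₂]
      congr 1
      simp [embed]
      linear_combination 2 * u * ω_sq

theorem avoids_triPatterns {p u : ℂ} (hu : ‖u‖ = 1) :
    ∀ P ∈ triPatterns, Avoids (pullback h p u) P := by
  have hsub {v : Vec} (hv : v ∈ triUnits) : v ∈ triUnits ++ rotUnits ++ diffUnits :=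
    List.mem_append_left _ (List.mem_append_left _ hv)
  intro P hP
  rcases List.mem_append.1 hP with hP | hP
  · rcases List.mem_append.1 hP with hP | hP <;> obtain ⟨v, hv, rfl⟩ := List.mem_map.1 hP
    · exact hh.avoids_redPair hu (hsub hv)
    · exact hh.avoids_blueFive hu (hsub hv)
  · exact hh.avoids_redTriangles hu P hP

theorem not_red_of_check {d : ℤ} {t : BitSearch.Plan}
    (hcheck : check triPatterns (box 4 0) [0, (d, 0, 0, 0)] t = true) {p u : ℂ} (hu : ‖u‖ = 1)
    (h₀ : h p = true) : h (p + d * u) = false := by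
  obtain ⟨x, hx, hblue⟩ := exists_blue_of_check (hh.avoids_triPatterns (p := p) hu) hcheck
  fin_cases hx
  · simp [pullback, embed, h₀] at hblue
  · simpa [pullback, embed, mul_comm u] using hblue

theorem red_add_five {p u : ℂ} (hu : ‖u‖ = 1) (h₀ : h p = true) : h (p + 5 * u) = true := by
  have h₂ := hh.not_red_of_check check_two hu h₀
  have h₃ := hh.not_red_of_check check_three hu h₀
  have h₄ := hh.not_red_of_check check_four hu h₀
  obtain ⟨k, hk, hred⟩ := hh.exists_red (p + u) u hu
  have hred : h (p + ((k + 1 : ℕ) : ℂ) * u) = true := by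
    rw [← hred]
    push_cast
    ring_nf
  interval_cases k
  · exact (hh.not_red_pair p u hu h₀ (by simpa using hred)).elim
  · norm_num [h₂] at hred h₂
    simp [h₂] at hred
  · norm_num at hred h₃
    simp [h₃] at hred
  · norm_num at hred h₄
    simp [h₄] at hred
  · simpa using hred

end Good

theorem not_good (h : ℂ → Bool) : ¬ Good h := by
  intro hh
  obtain ⟨k, -, hz⟩ := hh.exists_red 0 1 norm_one
  have h99 : √99 * √99 = 99 := Real.mul_self_sqrt (by norm_num)
  have hw : ‖(⟨√99 / 10, 1 / 10⟩ : ℂ)‖ = 1 := by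
    apply norm_eq_one_of_normSq
    rw [normSq_mk]
    linarith
  have hw' : ‖(⟨-√99 / 10, 1 / 10⟩ : ℂ)‖ = 1 := by
    apply norm_eq_one_of_normSq
    rw [normSq_mk]
    linarith
  refine hh.not_red_pair _ I norm_I hz ?_
  have hI : (5 : ℂ) * ⟨√99 / 10, 1 / 10⟩ + 5 * ⟨-√99 / 10, 1 / 10⟩ = I := by
    apply Complex.ext <;> norm_num [mul_re, mul_im]
    ring
  rw [← hI, ← add_assoc]
  exact hh.red_add_five hw' (hh.red_add_five hw hz)

end UnitDistance

/-- If the plane is red-blue coloured with no two red points at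
distance 1, then there are five blue points forming an ℓ₅: a point `p` and a
unit vector `w` with `p, p+w, p+2w, p+3w, p+4w` all blue. -/
theorem stmt_0 (c : Plane → Color)
    (hred : ∀ x y : Plane, c x = Color.red → c y = Color.red → dist x y ≠ 1) :
    ∃ p w : Plane, ‖w‖ = 1 ∧ ∀ i : Fin 5, c (p + (i : ℝ) • w) = Color.blue := by
  by_contra! hblue
  let e := Complex.orthonormalBasisOneI.repr
  have hc (x : Plane) : c x = Color.red ∨ c x = Color.blue := by
    cases c x <;> simp
  classical
  refine UnitDistance.not_good (fun z => decide (c (e z) = Color.red)) ⟨?_, ?_⟩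
  · intro z u hu h₀ h₁
    refine hred _ _ (of_decide_eq_true h₁) (of_decide_eq_true h₀) ?_
    rw [e.dist_map, dist_eq_norm, add_sub_cancel_left, hu]
  · intro z u hu
    obtain ⟨i, hi⟩ := hblue (e z) (e u) (by rw [e.norm_map, hu])
    refine ⟨i, i.isLt, decide_eq_true ?_⟩
    convert (hc _).resolve_right hi using 2
    rw [map_add, ← map_smul, Complex.real_smul, Complex.ofReal_natCast]
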